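/- Let (G₁, G₂) be a centered bivariate Gaussian vector with unit variances and correlation ρ with |ρ| < 1. Then for all real x, y: |P(G₁ ≥ x, G₂ ≥ y) − (1 − Φ(x))(1 − Φ(y))| ≤ |ρ|/4, where Φ is the standard normal CDF. -/

import Mathlib

open MeasureTheory ProbabilityTheory

namespace Stmt17Aux

open Set Filter Topology

noncomputable def p (u : ℝ) : ℝ := (Real.sqrt (2 * Real.pi))⁻¹ * Real.exp (-u ^ 2 / 2)

lemma pdf_eq : gaussianPDFReal 0 1 = p := by
  funext u
  simp [gaussianPDFReal, p]

lemma p_nonneg (u : ℝ) : 0 ≤ p u := by unfold p; positivity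

lemma p_cont : Continuous p := by unfold p; fun_prop

lemma p_int : Integrable p := by
  rw [← pdf_eq]; exact integrable_gaussianPDFReal 0 1

lemma p_le_one (u : ℝ) : p u ≤ 1 := by
  unfold p
  have h1 : (Real.sqrt (2 * Real.pi))⁻¹ ≤ 1 := by
    apply inv_le_one_of_one_le₀
    rw [Real.one_le_sqrt]
    nlinarith [Real.pi_gt_three]
  have h2 : Real.exp (-u ^ 2 / 2) ≤ 1 := by
    rw [Real.exp_le_one_iff]; nlinarith [sq_nonneg u]
  exact mul_le_one₀ h1 (Real.exp_pos _).le h2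

lemma mul_p_int : Integrable (fun u => u * p u) := by
  have h := (integrable_mul_exp_neg_mul_sq (b := 1/2) (by norm_num)).const_mul
    (Real.sqrt (2 * Real.pi))⁻¹
  refine h.congr (ae_of_all _ fun u => ?_)
  simp only [p]
  ring_nf

noncomputable def Q (t : ℝ) : ℝ := ∫ v in Ioi t, p v

lemma gauss_Ioi (t : ℝ) : (gaussianReal 0 1).real (Ioi t) = Q t := by
  rw [measureReal_def, gaussianReal_apply_eq_integral _ one_ne_zero, pdf_eq, ENNReal.toReal_ofReal]
  · rfl
  · exact integral_nonneg p_nonneg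

lemma gauss_Ici (t : ℝ) : (gaussianReal 0 1).real (Ici t) = Q t := by
  rw [measureReal_def, gaussianReal_apply_eq_integral _ one_ne_zero, pdf_eq, ENNReal.toReal_ofReal,
    integral_Ici_eq_integral_Ioi]
  · rfl
  · exact integral_nonneg p_nonneg

lemma Q_nonneg (t : ℝ) : 0 ≤ Q t := by rw [← gauss_Ioi]; exact measureReal_nonneg

lemma Q_le_one (t : ℝ) : Q t ≤ 1 := by rw [← gauss_Ioi]; exact measureReal_le_one

lemma Q_deriv (t : ℝ) : HasDerivAt Q (-p t) t := by
  have h : Q = fun t => Q 0 - ∫ v in (0:ℝ)..t, p v := by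
    funext t
    have := intervalIntegral.integral_interval_add_Ioi (a := 0) (b := t) (f := p) (μ := volume)
      p_int.integrableOn p_int.integrableOn
    simp only [Q]; linarith
  rw [h]
  exact (intervalIntegral.integral_hasDerivAt_right p_int.intervalIntegrable
    p_cont.aestronglyMeasurable.stronglyMeasurableAtFilter p_cont.continuousAt).const_sub _

lemma Q_cont : Continuous Q :=
  continuous_iff_continuousAt.2 fun t => (Q_deriv t).continuousAt

noncomputable def F (x y θ : ℝ) : ℝ :=
  ∫ u in Ioi x, p u * Q ((y - Real.sin θ * u) / Real.cos θ)

noncomputable def dF (y θ u : ℝ) : ℝ :=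
  p u * (p ((y - Real.sin θ * u) / Real.cos θ) * ((u - y * Real.sin θ) / Real.cos θ ^ 2))

lemma dF_deriv (y θ u : ℝ) (h : 0 < Real.cos θ) :
    HasDerivAt (fun θ => p u * Q ((y - Real.sin θ * u) / Real.cos θ)) (dF y θ u) θ := by
  have h1 : HasDerivAt (fun θ => (y - Real.sin θ * u) / Real.cos θ)
      (-((u - y * Real.sin θ) / Real.cos θ ^ 2)) θ := by
    have := (((Real.hasDerivAt_sin θ).mul_const u).const_sub y).div (Real.hasDerivAt_cos θ) h.ne'
    refine this.congr_deriv ?_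
    rw [← neg_div]
    congr 1
    have := Real.sin_sq_add_cos_sq θ
    linear_combination (-u) * this
  have h2 := ((Q_deriv _).comp θ h1).const_mul (p u)
  refine h2.congr_deriv ?_
  unfold dF; ring

lemma F_deriv (x y θ : ℝ) (h : 0 < Real.cos θ) :
    IntegrableOn (dF y θ) (Ioi x) ∧ HasDerivAt (F x y) (∫ u in Ioi x, dF y θ u) θ := by
  have hs : {t | Real.cos θ / 2 < Real.cos t} ∈ 𝓝 θ :=
    (isOpen_lt continuous_const Real.continuous_cos).mem_nhds (by simp only [mem_ofPred_eq]; linarith)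
  refine hasDerivAt_integral_of_dominated_loc_of_deriv_le (μ := volume.restrict (Ioi x))
    (F := fun θ u => p u * Q ((y - Real.sin θ * u) / Real.cos θ)) (F' := dF y) (x₀ := θ)
    (bound := fun u => ((Real.cos θ / 2) ^ 2)⁻¹ * (‖u * p u‖ + |y| * p u)) hs ?_ ?_ ?_ ?_ ?_ ?_
  · refine Eventually.of_forall fun t => Continuous.aestronglyMeasurable ?_
    exact p_cont.mul (Q_cont.comp (by fun_prop))
  · refine Integrable.mono' p_int.restrict (Continuous.aestronglyMeasurable ?_) (ae_of_all _ ?_)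
    · exact p_cont.mul (Q_cont.comp (by fun_prop))
    · intro u
      rw [Real.norm_eq_abs, abs_of_nonneg (mul_nonneg (p_nonneg _) (Q_nonneg _))]
      exact mul_le_of_le_one_right (p_nonneg _) (Q_le_one _)
  · refine Continuous.aestronglyMeasurable ?_
    unfold dF
    exact p_cont.mul ((p_cont.comp (by fun_prop)).mul (by fun_prop))
  · refine ae_of_all _ fun u t ht => ?_
    simp only [mem_ofPred_eq] at ht
    have hc : 0 < Real.cos t := by linarith
    simp only [dF, Real.norm_eq_abs, abs_mul, abs_div, abs_of_nonneg (p_nonneg _), abs_pow,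
      abs_of_pos hc]
    have e1 : |u - y * Real.sin t| ≤ |u| + |y| := by
      refine (abs_sub _ _).trans ?_
      rw [abs_mul]
      have := mul_le_of_le_one_right (abs_nonneg y) (Real.abs_sin_le_one t)
      linarith
    have e2 : |u - y * Real.sin t| / Real.cos t ^ 2 ≤ (|u| + |y|) / (Real.cos θ / 2) ^ 2 := by
      gcongr
    calc _ ≤ p u * (1 * ((|u| + |y|) / (Real.cos θ / 2) ^ 2)) := by
          refine mul_le_mul_of_nonneg_left ?_ (p_nonneg _)
          exact mul_le_mul (p_le_one _) e2 (by positivity) zero_le_one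
      _ = _ := by rw [div_eq_mul_inv]; ring
  · exact ((mul_p_int.norm.add (p_int.const_mul _)).const_mul _).restrict
  · refine ae_of_all _ fun u t ht => dF_deriv y t u ?_
    simp only [mem_ofPred_eq] at ht
    linarith

noncomputable def H (y θ u : ℝ) : ℝ :=
  -((2 * Real.pi)⁻¹ * Real.exp (-((u - y * Real.sin θ) ^ 2 / (2 * Real.cos θ ^ 2) + y ^ 2 / 2)))

lemma H_deriv (y θ u : ℝ) (h : 0 < Real.cos θ) : HasDerivAt (H y θ) (dF y θ u) u := by
  have h1 : HasDerivAt (fun u => -((u - y * Real.sin θ) ^ 2 / (2 * Real.cos θ ^ 2) + y ^ 2 / 2))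
      (-((u - y * Real.sin θ) / Real.cos θ ^ 2)) u := by
    have := (((((hasDerivAt_id u).sub_const (y * Real.sin θ)).pow 2).div_const
      (2 * Real.cos θ ^ 2)).add_const (y ^ 2 / 2)).neg
    refine this.congr_deriv ?_
    simp
    field_simp
  have h2 := (h1.exp.const_mul (2 * Real.pi)⁻¹).neg
  refine h2.congr_deriv ?_
  unfold dF p
  have e : -((u - y * Real.sin θ) ^ 2 / (2 * Real.cos θ ^ 2) + y ^ 2 / 2)
      = -u ^ 2 / 2 + -((y - Real.sin θ * u) / Real.cos θ) ^ 2 / 2 := by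
    have := Real.sin_sq_add_cos_sq θ
    have hs : Real.sin θ ^ 2 = 1 - Real.cos θ ^ 2 := by linarith
    field_simp
    ring_nf
    rw [hs]; ring
  have e3 : (2 * Real.pi)⁻¹ = (Real.sqrt (2 * Real.pi))⁻¹ * (Real.sqrt (2 * Real.pi))⁻¹ := by
    rw [← mul_inv, Real.mul_self_sqrt (by positivity)]
  rw [e, Real.exp_add, e3]
  ring

lemma H_tendsto (y θ : ℝ) (h : 0 < Real.cos θ) : Tendsto (H y θ) atTop (𝓝 0) := by
  have h0 : Tendsto (fun u => u - y * Real.sin θ) atTop atTop :=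
    tendsto_atTop_add_const_right _ _ tendsto_id
  have h1 : Tendsto (fun u => (u - y * Real.sin θ) ^ 2 / (2 * Real.cos θ ^ 2) + y ^ 2 / 2)
      atTop atTop :=
    tendsto_atTop_add_const_right _ _
      (((tendsto_pow_atTop two_ne_zero).comp h0).atTop_div_const (by positivity))
  have h2 := ((Real.tendsto_exp_neg_atTop_nhds_zero.comp h1).const_mul (2 * Real.pi)⁻¹).neg
  rw [mul_zero, neg_zero] at h2
  exact h2

lemma dF_bound (x y θ : ℝ) (h : 0 < Real.cos θ) :
    ‖∫ u in Ioi x, dF y θ u‖ ≤ (2 * Real.pi)⁻¹ := by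
  rw [integral_Ioi_of_hasDerivAt_of_tendsto' (fun u _ => H_deriv y θ u h) (F_deriv x y θ h).1
    (H_tendsto y θ h)]
  unfold H
  rw [zero_sub, neg_neg, Real.norm_eq_abs, abs_of_nonneg (by positivity)]
  refine mul_le_of_le_one_right (by positivity) ?_
  rw [Real.exp_le_one_iff, neg_nonpos]
  positivity

lemma F_lip (x y θ : ℝ) (h : θ ∈ Ioo (-(Real.pi / 2)) (Real.pi / 2)) :
    |F x y θ - F x y 0| ≤ (2 * Real.pi)⁻¹ * |θ| := by
  have := Convex.norm_image_sub_le_of_norm_hasDerivWithin_le (f := F x y)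
    (f' := fun θ => ∫ u in Ioi x, dF y θ u) (s := Ioo (-(Real.pi / 2)) (Real.pi / 2))
    (x := 0) (y := θ)
    (fun t ht => (F_deriv x y t (Real.cos_pos_of_mem_Ioo ht)).2.hasDerivWithinAt)
    (fun t ht => dF_bound x y t (Real.cos_pos_of_mem_Ioo ht)) (convex_Ioo _ _)
    ⟨by linarith [Real.pi_pos], by linarith [Real.pi_pos]⟩ h
  simpa using this

lemma F_zero (x y : ℝ) : F x y 0 = Q x * Q y := by
  simp [F, integral_mul_const, Q]

lemma arcsin_bound (ρ : ℝ) (h : |ρ| ≤ 1) : |Real.arcsin ρ| ≤ Real.pi / 2 * |ρ| := by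
  have key : ∀ r : ℝ, 0 ≤ r → r ≤ 1 → Real.arcsin r ≤ Real.pi / 2 * r := by
    intro r h0 h1
    have := Real.mul_le_sin (Real.arcsin_nonneg.2 h0) (Real.arcsin_le_pi_div_two r)
    rw [Real.sin_arcsin (by linarith) h1] at this
    have hp := Real.pi_pos
    calc Real.arcsin r = Real.pi / 2 * (2 / Real.pi * Real.arcsin r) := by field_simp
      _ ≤ _ := by gcongr
  have hh := abs_le.1 h
  rcases le_total 0 ρ with h0 | h0
  · rw [abs_of_nonneg h0, abs_of_nonneg (Real.arcsin_nonneg.2 h0)]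
    exact key _ h0 hh.2
  · rw [abs_of_nonpos h0, abs_of_nonpos (Real.arcsin_nonpos.2 h0), ← Real.arcsin_neg]
    exact key _ (by linarith) (by linarith)

lemma meas_set (x y a b : ℝ) :
    MeasurableSet {z : ℝ × ℝ | x ≤ z.1 ∧ y ≤ a * z.1 + b * z.2} := by
  have h1 : MeasurableSet {z : ℝ × ℝ | x ≤ z.1} := measurableSet_le measurable_const measurable_fst
  have h2 : MeasurableSet {z : ℝ × ℝ | y ≤ a * z.1 + b * z.2} :=
    measurableSet_le measurable_const (by fun_prop)
  exact h1.inter h2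

lemma prod_eq (x y θ : ℝ) (h : 0 < Real.cos θ) :
    ((gaussianReal 0 1).prod (gaussianReal 0 1)).real
      {z : ℝ × ℝ | x ≤ z.1 ∧ y ≤ Real.sin θ * z.1 + Real.cos θ * z.2} = F x y θ := by
  have hms : MeasurableSet
      {z : ℝ × ℝ | x ≤ z.1 ∧ y ≤ Real.sin θ * z.1 + Real.cos θ * z.2} := by
    exact meas_set x y _ _
  have hsec : ∀ u : ℝ, (gaussianReal 0 1 (Prod.mk u ⁻¹'
      {z : ℝ × ℝ | x ≤ z.1 ∧ y ≤ Real.sin θ * z.1 + Real.cos θ * z.2})).toReal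
      = (Ici x).indicator (fun u => Q ((y - Real.sin θ * u) / Real.cos θ)) u := by
    intro u
    by_cases hu : x ≤ u
    · rw [indicator_of_mem (by exact hu), ← gauss_Ici, measureReal_def]
      congr 2
      ext v
      simp only [mem_preimage, mem_ofPred_eq, hu, true_and, mem_Ici]
      rw [div_le_iff₀ h]
      constructor <;> intro _ <;> linarith
    · rw [indicator_of_notMem (by exact hu)]
      simp [hu]
  rw [measureReal_def, Measure.prod_apply hms, ← integral_toReal]
  · simp_rw [hsec]
    rw [integral_gaussianReal_eq_integral_smul one_ne_zero, pdf_eq, F,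
      ← integral_Ici_eq_integral_Ioi, ← integral_indicator measurableSet_Ici]
    congr 1
    funext u
    by_cases hu : u ∈ Ici x <;> simp [indicator, hu]
  · exact (measurable_measure_prodMk_left hms).aemeasurable
  · exact ae_of_all _ fun u => measure_lt_top _ _

lemma one_sub (t : ℝ) : 1 - ((gaussianReal 0 1) (Iic t)).toReal = Q t := by
  rw [← gauss_Ioi, ← compl_Iic, probReal_compl_eq_one_sub measurableSet_Iic, measureReal_def]

end Stmt17Aux

theorem stmt17 {Ω : Type*} [MeasurableSpace Ω] (μ : Measure Ω) [IsProbabilityMeasure μ]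
    (Z₁ Z₂ : Ω → ℝ) (hm1 : Measurable Z₁) (hm2 : Measurable Z₂)
    (h1 : Measure.map Z₁ μ = gaussianReal 0 1)
    (h2 : Measure.map Z₂ μ = gaussianReal 0 1)
    (hind : IndepFun Z₁ Z₂ μ)
    (ρ : ℝ) (hρ : |ρ| < 1)
    (G₁ G₂ : Ω → ℝ) (hG1 : G₁ = Z₁)
    (hG2 : G₂ = fun ω => ρ * Z₁ ω + Real.sqrt (1 - ρ ^ 2) * Z₂ ω)
    (x y : ℝ) :
    |(μ {ω | x ≤ G₁ ω ∧ y ≤ G₂ ω}).toReal -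
        (1 - ((gaussianReal 0 1) (Set.Iic x)).toReal) *
          (1 - ((gaussianReal 0 1) (Set.Iic y)).toReal)|
      ≤ |ρ| / 4 := by
  obtain ⟨hl, hr⟩ := abs_lt.1 hρ
  have hθ : Real.arcsin ρ ∈ Set.Ioo (-(Real.pi / 2)) (Real.pi / 2) :=
    ⟨Real.neg_pi_div_two_lt_arcsin.2 hl, Real.arcsin_lt_pi_div_two.2 hr⟩
  have hc := Real.cos_pos_of_mem_Ioo hθ
  have hP : (μ {ω | x ≤ G₁ ω ∧ y ≤ G₂ ω}).toReal = Stmt17Aux.F x y (Real.arcsin ρ) := by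
    rw [← Stmt17Aux.prod_eq x y _ hc]
    have hprod := (indepFun_iff_map_prod_eq_prod_map_map hm1.aemeasurable hm2.aemeasurable).1 hind
    rw [h1, h2] at hprod
    rw [← hprod, measureReal_def, Measure.map_apply (hm1.prodMk hm2)]
    · rw [Real.sin_arcsin hl.le hr.le, Real.cos_arcsin, hG1, hG2]
      rfl
    · exact Stmt17Aux.meas_set x y _ _
  rw [hP, Stmt17Aux.one_sub, Stmt17Aux.one_sub, ← Stmt17Aux.F_zero]
  refine (Stmt17Aux.F_lip x y _ hθ).trans ?_
  have hpi := Real.pi_pos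
  calc (2 * Real.pi)⁻¹ * |Real.arcsin ρ| ≤ (2 * Real.pi)⁻¹ * (Real.pi / 2 * |ρ|) := by
        gcongr
        exact Stmt17Aux.arcsin_bound ρ hρ.le
    _ = |ρ| / 4 := by field_simp; ring
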